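/- arXiv:1412.4697 — 2 statements merged into one kernel-verified Lean document; each statement's English description precedes it below -/
import Mathlib

section
/- Let u, Q, Qb, H : ℂ × ℂ → ℂ be C² functions solving the Gauss–Codazzi system: ∂∂̄u + (1/2)H²e^u − 2Q·Qb·e^{−u} = 0, ∂Qb − (1/2)e^u·∂̄H = 0, ∂̄Q − (1/2)e^u·∂H = 0. Let g : ℂ → ℂ be an entire (holomorphic) function and let h : ℂ → ℂ be an entire function with exp(h(z)) = g′(z) for all z. Then the transformed functions ũ(z, w) = u(g(z), w) + h(z), Q̃(z, w) = g′(z)²·Q(g(z), w), Q̃b(z, w) = Qb(g(z), w), H̃(z, w) = H(g(z), w) also solve the Gauss–Codazzi system. (This is the finite conformal transformation in the first variable generated by the symmetry vector fields X(η) = η(z)∂_z − 2η′(z)Q∂_Q − η′(z)U∂_U.) -/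
open Complex

/-- Partial derivative with respect to the first complex variable `z`. -/
noncomputable def pd1 (f : ℂ × ℂ → ℂ) (p : ℂ × ℂ) : ℂ :=
  deriv (fun z => f (z, p.2)) p.1

/-- Partial derivative with respect to the second complex variable `w` (playing the role of `z̄`). -/
noncomputable def pd2 (f : ℂ × ℂ → ℂ) (p : ℂ × ℂ) : ℂ :=
  deriv (fun w => f (p.1, w)) p.2

/-- The classical Gauss–Codazzi system for conformally parametrized surfaces in ℝ³. -/
def GaussCodazzi (u Q Qb H : ℂ × ℂ → ℂ) : Prop :=
  ∀ p : ℂ × ℂ,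
    pd1 (pd2 u) p + (1/2) * (H p)^2 * exp (u p) - 2 * Q p * Qb p * exp (-u p) = 0 ∧
    pd1 Qb p - (1/2) * exp (u p) * pd2 H p = 0 ∧
    pd2 Q p - (1/2) * exp (u p) * pd1 H p = 0

/-- For differentiable `f`, the partial derivative `pd2 f` is `fderiv` applied to `(0, 1)`. -/
theorem pd2_eq_fderiv {f : ℂ × ℂ → ℂ} (hf : Differentiable ℂ f) :
    pd2 f = fun p => fderiv ℂ f p (0, 1) := by
  funext p
  have hpath : HasDerivAt (fun w : ℂ => (p.1, w)) ((0, 1) : ℂ × ℂ) p.2 :=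
    (hasDerivAt_const p.2 p.1).prodMk (hasDerivAt_id p.2)
  exact ((hf (p.1, p.2)).hasFDerivAt.comp_hasDerivAt p.2 hpath).deriv

theorem differentiable_pd2 {f : ℂ × ℂ → ℂ} (hf : ContDiff ℂ 2 f) :
    Differentiable ℂ (pd2 f) := by
  rw [pd2_eq_fderiv (hf.differentiable (by norm_num))]
  have hdf : ContDiff ℂ 1 (fderiv ℂ f) := hf.fderiv_right (by norm_num)
  exact (hdf.differentiable (by norm_num)).clm_apply (differentiable_const _)

/-- Chain rule for a reparametrization of the first variable. -/
theorem pd1_comp_fst {f : ℂ × ℂ → ℂ} {g : ℂ → ℂ} (hf : Differentiable ℂ f)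
    (hg : Differentiable ℂ g) (p : ℂ × ℂ) :
    pd1 (fun q => f (g q.1, q.2)) p = deriv g p.1 * pd1 f (g p.1, p.2) := by
  have hslice : DifferentiableAt ℂ (fun z => f (z, p.2)) (g p.1) := by fun_prop
  have hcomp := hslice.hasDerivAt.comp p.1 (hg p.1).hasDerivAt
  rw [mul_comm]
  exact hcomp.deriv

/-- The finite conformal symmetry in the first variable, generated by
`X(η) = η(z)∂_z − 2η′(z)Q∂_Q − η′(z)U∂_U`: if `(u, Q, Qb, H)` solves the Gauss–Codazzi
system, `g` is entire and `h` is an entire logarithm of `g′`, then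
`(u(g z, w) + h z, g′(z)² Q(g z, w), Qb(g z, w), H(g z, w))` also solves it. -/
theorem gauss_codazzi_conformal_symmetry_first
    (u Q Qb H : ℂ × ℂ → ℂ)
    (hu : ContDiff ℂ 2 u) (hQ : ContDiff ℂ 2 Q) (hQb : ContDiff ℂ 2 Qb)
    (hH : ContDiff ℂ 2 H)
    (hGC : GaussCodazzi u Q Qb H)
    (g h : ℂ → ℂ) (hg : Differentiable ℂ g) (hh : Differentiable ℂ h)
    (hgh : ∀ z : ℂ, exp (h z) = deriv g z) :
    GaussCodazzi (fun p => u (g p.1, p.2) + h p.1)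
      (fun p => (deriv g p.1)^2 * Q (g p.1, p.2))
      (fun p => Qb (g p.1, p.2))
      (fun p => H (g p.1, p.2)) := by
  intro p
  obtain ⟨gauss, codazzi_Qb, codazzi_Q⟩ := hGC (g p.1, p.2)
  have hpd2u : pd2 (fun q => u (g q.1, q.2) + h q.1) = fun q => pd2 u (g q.1, q.2) := by
    funext q
    simp only [pd2, deriv_add_const]
  have hpd2Q : pd2 (fun q => (deriv g q.1) ^ 2 * Q (g q.1, q.2)) p
      = (deriv g p.1) ^ 2 * pd2 Q (g p.1, p.2) := by
    simp only [pd2, deriv_const_mul_field]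
  have hpd2H : pd2 (fun q => H (g q.1, q.2)) p = pd2 H (g p.1, p.2) := rfl
  have hg' : deriv g p.1 ≠ 0 := hgh p.1 ▸ exp_ne_zero _
  have hexp_neg : exp (-(u (g p.1, p.2) + h p.1))
      = exp (-u (g p.1, p.2)) * (deriv g p.1)⁻¹ := by
    rw [neg_add, exp_add, exp_neg (h p.1), hgh]
  refine ⟨?_, ?_, ?_⟩
  · rw [hpd2u, pd1_comp_fst (differentiable_pd2 hu) hg]
    simp only [hexp_neg, exp_add, hgh]
    field_simp
    linear_combination 2 * deriv g p.1 * gauss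
  · rw [pd1_comp_fst (hQb.differentiable (by norm_num)) hg, hpd2H]
    simp only [exp_add, hgh]
    linear_combination deriv g p.1 * codazzi_Qb
  · rw [hpd2Q, pd1_comp_fst (hH.differentiable (by norm_num)) hg]
    simp only [exp_add, hgh]
    linear_combination (deriv g p.1) ^ 2 * codazzi_Q
end

section
/- Let a, k₀, l₀, c ∈ ℂ with exp(c) = −2k₀/l₀ (so in particular l₀ ≠ 0 and k₀ ≠ 0). Define functions on ℂ × ℂ by u(z, w) = 2a(z + w) + c, Q(z, w) = k₀·e^{a(z+w)}, Qb(z, w) = k₀·e^{a(z+w)}, H(z, w) = l₀·e^{−a(z+w)}. Then (u, Q, Qb, H) solves the Gauss–Codazzi system: ∂∂̄u + (1/2)H²e^u − 2Q·Qb·e^{−u} = 0, ∂Qb − (1/2)e^u·∂̄H = 0, ∂̄Q − (1/2)e^u·∂H = 0; moreover its Gaussian curvature 𝒦 = H² − 4·Q·Qb·e^{−2u} vanishes identically, while the mean curvature H is nowhere zero. -/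
open Complex

lemma pd1_const_mul_exp (k b : ℂ) (p : ℂ × ℂ) :
    pd1 (fun q => k * exp (b * (q.1 + q.2))) p = b * (k * exp (b * (p.1 + p.2))) := by
  have h := (((((hasDerivAt_id p.1).add_const p.2).const_mul b).cexp).const_mul k).deriv
  simp only [id] at h
  rw [pd1, h]
  ring

lemma pd2_const_mul_exp (k b : ℂ) (p : ℂ × ℂ) :
    pd2 (fun q => k * exp (b * (q.1 + q.2))) p = b * (k * exp (b * (p.1 + p.2))) := by
  have h := (((((hasDerivAt_id p.2).const_add p.1).const_mul b).cexp).const_mul k).deriv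
  simp only [id] at h
  rw [pd2, h]
  ring

lemma pd2_affine (b c : ℂ) :
    pd2 (fun q => b * (q.1 + q.2) + c) = fun _ => b := by
  funext p
  have h := ((((hasDerivAt_id p.2).const_add p.1).const_mul b).add_const c).deriv
  simp only [id] at h
  rw [pd2, h, mul_one]

lemma pd1_const (b : ℂ) (p : ℂ × ℂ) : pd1 (fun _ => b) p = 0 :=
  deriv_const p.1 b

/-- The invariant solution of the classical Gauss–Codazzi equations associated with the
subalgebra `L′₁,₂ = {e₃ + a e₀}`: `u = 2a(z+w) + c`, `Q = Qb = k₀e^{a(z+w)}`,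
`H = l₀e^{−a(z+w)}` with `e^c = −2k₀/l₀` solves the system, has identically vanishing
Gaussian curvature `𝒦 = H² − 4QQb·e^{−2u}`, and nowhere vanishing mean curvature `H`. -/
theorem gauss_codazzi_invariant_solution_L12
    (a k₀ l₀ c : ℂ) (hc : exp c = -2 * k₀ / l₀)
    (u Q Qb H : ℂ × ℂ → ℂ)
    (hu : u = fun p => 2 * a * (p.1 + p.2) + c)
    (hQ : Q = fun p => k₀ * exp (a * (p.1 + p.2)))
    (hQb : Qb = fun p => k₀ * exp (a * (p.1 + p.2)))
    (hH : H = fun p => l₀ * exp (-(a * (p.1 + p.2)))) :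
    l₀ ≠ 0 ∧ k₀ ≠ 0 ∧
    GaussCodazzi u Q Qb H ∧
    (∀ p : ℂ × ℂ, (H p)^2 - 4 * Q p * Qb p * exp (-(2 * u p)) = 0) ∧
    (∀ p : ℂ × ℂ, H p ≠ 0) := by
  have hl : l₀ ≠ 0 := by
    rintro rfl
    simp at hc
  have hk : k₀ ≠ 0 := by
    rintro rfl
    simp at hc
  have hexp_u (x : ℂ) : exp (2 * a * x + c) = exp (a * x) ^ 2 * (-2 * k₀ / l₀) := by
    rw [exp_add, hc, ← exp_nat_mul]
    congr 2
    push_cast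
    ring
  have hH' : H = fun p => l₀ * exp (-a * (p.1 + p.2)) := by
    simpa only [neg_mul] using hH
  refine ⟨hl, hk, fun p => ⟨?_, ?_, ?_⟩, fun p => ?_, fun p => ?_⟩
  · rw [hu, pd2_affine, pd1_const, hQ, hQb, hH]
    have hE := exp_ne_zero (a * (p.1 + p.2))
    simp only [exp_neg, hexp_u]
    field_simp
    ring
  · rw [hu, hQb, hH', pd1_const_mul_exp, pd2_const_mul_exp]
    have hE := exp_ne_zero (a * (p.1 + p.2))
    simp only [neg_mul a, exp_neg, hexp_u]
    field_simp
    ring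
  · rw [hu, hQ, hH', pd1_const_mul_exp, pd2_const_mul_exp]
    have hE := exp_ne_zero (a * (p.1 + p.2))
    simp only [neg_mul a, exp_neg, hexp_u]
    field_simp
    ring
  · have hE := exp_ne_zero (a * (p.1 + p.2))
    rw [hu, hQ, hQb, hH]
    simp only [exp_neg, two_mul (2 * a * (p.1 + p.2) + c),
      exp_add (2 * a * (p.1 + p.2) + c), hexp_u]
    field_simp
    ring
  · rw [hH]
    exact mul_ne_zero hl (exp_ne_zero _)
end
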